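/- (Eqs. (7)–(8)): Let X and Y be random variables with finite ranges on a probability space, and let Z₁ = f₁(X) and Z₂ = f₂(X) be two representations of X that are both sufficient for Y, i.e., I(Z₁;Y) = I(X;Y) and I(Z₂;Y) = I(X;Y). If I(Z₁;X) ≤ I(Z₂;X), then 0 ≤ I(X;Z₁|Y) ≤ I(X;Z₂|Y); that is, the representation with smaller total information about X retains no more instance-specific information than the other, and its instance-specific information is nonnegative. -/

import Mathlib

open MeasureTheory ProbabilityTheory Real

/-- Shannon entropy of a random variable `X` with finite range (codomain a `Fintype`),
with respect to the measure `μ`. -/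
noncomputable def entropy {Ω S : Type*} [MeasurableSpace Ω] [Fintype S]
    (μ : Measure Ω) (X : Ω → S) : ℝ :=
  ∑ s : S, Real.negMulLog (μ (X ⁻¹' {s})).toReal

/-- Shannon mutual information `I(X;Y)` of two finite-range random variables. -/
noncomputable def mutualInfo {Ω S T : Type*} [MeasurableSpace Ω] [Fintype S] [Fintype T]
    (μ : Measure Ω) (X : Ω → S) (Y : Ω → T) : ℝ :=
  entropy μ X + entropy μ Y - entropy μ (fun ω => (X ω, Y ω))

/-- Conditional mutual information `I(X;Z|Y)` of finite-range random variables,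
via the chain-rule formula `H(X,Y) + H(Z,Y) - H(X,Z,Y) - H(Y)`. -/
noncomputable def condMutualInfo {Ω S T U : Type*} [MeasurableSpace Ω]
    [Fintype S] [Fintype T] [Fintype U]
    (μ : Measure Ω) (X : Ω → S) (Z : Ω → T) (Y : Ω → U) : ℝ :=
  entropy μ (fun ω => (X ω, Y ω)) + entropy μ (fun ω => (Z ω, Y ω))
    - entropy μ (fun ω => (X ω, Z ω, Y ω)) - entropy μ Y

/-- `Real.negMulLog` is subadditive on nonnegative reals. -/
lemma negMulLog_sum_le_sum_negMulLog {ι : Type*} (s : Finset ι) (p : ι → ℝ)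
    (hp : ∀ i ∈ s, 0 ≤ p i) :
    Real.negMulLog (∑ i ∈ s, p i) ≤ ∑ i ∈ s, Real.negMulLog (p i) := by
  rw [Real.negMulLog, ← Finset.sum_neg_distrib, Finset.sum_mul]
  refine Finset.sum_le_sum fun i hi => ?_
  rcases (hp i hi).eq_or_lt with h | h
  · simp [← h]
  · rw [Real.negMulLog, neg_mul, neg_mul, neg_le_neg_iff]
    exact mul_le_mul_of_nonneg_left
      (Real.log_le_log h (Finset.single_le_sum hp hi)) h.le

/-- Entropy is invariant under injective relabelling of the values. -/
lemma entropy_comp_of_injective {Ω S T : Type*} [MeasurableSpace Ω] [Fintype S] [Fintype T]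
    (μ : Measure Ω) (X : Ω → S) {g : S → T} (hg : Function.Injective g) :
    entropy μ (fun ω => g (X ω)) = entropy μ X := by
  symm
  refine Finset.sum_of_injOn g hg.injOn (by simp) (fun t _ ht => ?_) fun s _ => ?_
  · have h : (fun ω => g (X ω)) ⁻¹' {t} = ∅ := by
      ext ω
      simp only [Set.mem_preimage, Set.mem_singleton_iff, Set.mem_empty_iff_false, iff_false]
      rintro rfl
      exact ht ⟨X ω, by simp, rfl⟩
    simp [h]
  · have h : (fun ω => g (X ω)) ⁻¹' {g s} = X ⁻¹' {s} := by
      ext ω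
      simp [hg.eq_iff]
    rw [h]

/-- The entropy of a marginal is at most the joint entropy. -/
lemma entropy_le_entropy_prodMk {Ω T U : Type*} [MeasurableSpace Ω]
    [Fintype T] [MeasurableSpace T] [MeasurableSingletonClass T]
    [Fintype U] [MeasurableSpace U] [MeasurableSingletonClass U]
    (μ : Measure Ω) [IsFiniteMeasure μ] {Z : Ω → T} {Y : Ω → U}
    (hZ : Measurable Z) (hY : Measurable Y) :
    entropy μ Y ≤ entropy μ (fun ω => (Z ω, Y ω)) := by
  rw [entropy, entropy, Fintype.sum_prod_type_right]
  refine Finset.sum_le_sum fun u _ => ?_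
  have h : (μ (Y ⁻¹' {u})).toReal
      = ∑ t : T, (μ ((fun ω => (Z ω, Y ω)) ⁻¹' {(t, u)})).toReal := by
    have hU : Y ⁻¹' {u} = ⋃ t ∈ Finset.univ, (fun ω => (Z ω, Y ω)) ⁻¹' {(t, u)} := by
      ext ω
      simp
    rw [hU, measure_biUnion_finset, ENNReal.toReal_sum fun _ _ => measure_ne_top _ _]
    · intro a _ b _ hab
      refine Set.disjoint_left.2 fun ω ha hb => hab ?_
      simp only [Set.mem_preimage, Set.mem_singleton_iff, Prod.mk.injEq] at ha hb
      exact ha.1.symm.trans hb.1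
    · exact fun t _ => (hZ.prodMk hY) (measurableSet_singleton _)
  rw [h]
  exact negMulLog_sum_le_sum_negMulLog _ _ fun _ _ => ENNReal.toReal_nonneg

/-- A deterministic function of `X` has mutual information with `X` equal to its entropy. -/
lemma mutualInfo_comp_self {Ω S T : Type*} [MeasurableSpace Ω] [Fintype S] [Fintype T]
    (μ : Measure Ω) (X : Ω → S) (f : S → T) :
    mutualInfo μ (fun ω => f (X ω)) X = entropy μ (fun ω => f (X ω)) := by
  have h := entropy_comp_of_injective μ X (g := fun x => (f x, x))
    fun _ _ h => congrArg Prod.snd h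
  rw [mutualInfo, h]
  ring

/-- For `Z = f(X)`, the conditional information `I(X;Z|Y)` is `H(Z,Y) - H(Y)`. -/
lemma condMutualInfo_comp {Ω S T U : Type*} [MeasurableSpace Ω]
    [Fintype S] [Fintype T] [Fintype U]
    (μ : Measure Ω) (X : Ω → S) (Y : Ω → U) (f : S → T) :
    condMutualInfo μ X (fun ω => f (X ω)) Y
      = entropy μ (fun ω => (f (X ω), Y ω)) - entropy μ Y := by
  have h := entropy_comp_of_injective μ (fun ω => (X ω, Y ω))
    (g := fun p : S × U => (p.1, f p.1, p.2)) fun a b h => by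
      simp only [Prod.mk.injEq] at h
      exact Prod.ext h.1 h.2.2
  rw [condMutualInfo, h]
  ring

/-- If `Z₁ = f₁ ∘ X` and `Z₂ = f₂ ∘ X` are both sufficient for `Y` and
`I(Z₁;X) ≤ I(Z₂;X)`, then `0 ≤ I(X;Z₁|Y) ≤ I(X;Z₂|Y)`. -/
theorem instance_specific_info_compare {Ω S T₁ T₂ U : Type*} [MeasurableSpace Ω]
    [Fintype S] [MeasurableSpace S] [MeasurableSingletonClass S]
    [Fintype T₁] [MeasurableSpace T₁] [MeasurableSingletonClass T₁]
    [Fintype T₂] [MeasurableSpace T₂] [MeasurableSingletonClass T₂]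
    [Fintype U] [MeasurableSpace U] [MeasurableSingletonClass U]
    (μ : Measure Ω) [IsProbabilityMeasure μ]
    (X : Ω → S) (Y : Ω → U) (f₁ : S → T₁) (f₂ : S → T₂)
    (hX : Measurable X) (hY : Measurable Y) (hf₁ : Measurable f₁) (hf₂ : Measurable f₂)
    (hsuf₁ : mutualInfo μ (fun ω => f₁ (X ω)) Y = mutualInfo μ X Y)
    (hsuf₂ : mutualInfo μ (fun ω => f₂ (X ω)) Y = mutualInfo μ X Y)
    (hle : mutualInfo μ (fun ω => f₁ (X ω)) X ≤ mutualInfo μ (fun ω => f₂ (X ω)) X) :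
    0 ≤ condMutualInfo μ X (fun ω => f₁ (X ω)) Y ∧
      condMutualInfo μ X (fun ω => f₁ (X ω)) Y ≤
        condMutualInfo μ X (fun ω => f₂ (X ω)) Y := by
  rw [mutualInfo_comp_self, mutualInfo_comp_self] at hle
  rw [condMutualInfo_comp, condMutualInfo_comp]
  refine ⟨sub_nonneg.2 (entropy_le_entropy_prodMk μ (hf₁.comp hX) hY), ?_⟩
  have h := hsuf₁.trans hsuf₂.symm
  rw [mutualInfo, mutualInfo] at h
  linarith
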